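/- Let 1 < σ ≤ 1.15, set σ1 = 1/2 + (1/2)·√(1+4σ²), let c ∈ {0,1}, let k ∈ {1,2,3,4}, and let γ0 > 1. Then (1/2)·Re( ψ((σ + i·k·γ0 + c)/2) − κ·ψ((σ1 + i·k·γ0 + c)/2) ) ≤ ((1−κ)/2)·log(γ0) + D(k), where D(1) = 0.3918, D(2) = 0.3915, D(3) = 0.4062, D(4) = 0.4266, and ψ = Γ'/Γ is the logarithmic derivative of the Gamma function. -/

import Mathlib

namespace ZFR

noncomputable def kappa : ℝ := 1 / Real.sqrt 5

noncomputable def sigma1 (σ : ℝ) : ℝ := 1 / 2 + Real.sqrt (1 + 4 * σ ^ 2) / 2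

/-- `ψ = Γ'/Γ`, the logarithmic derivative of the complex Gamma function. -/
noncomputable def psi (s : ℂ) : ℂ := logDeriv Complex.Gamma s

open Filter Topology Set

/-- An eventual upper bound for the derivatives of a pointwise convergent sequence of functions
on an interval bounds the derivative of the limit. -/
lemma hasDerivAt_le_of_tendsto {f : ℕ → ℝ → ℝ} {f' : ℕ → ℝ → ℝ} {g : ℝ → ℝ} {g' a b x M : ℝ}
    (hx : x ∈ Ioo a b) (hf : ∀ n, ∀ t ∈ Ioo a b, HasDerivAt (f n) (f' n t) t)
    (hM : ∀ᶠ n in atTop, ∀ t ∈ Ioo a b, f' n t ≤ M)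
    (hlim : ∀ t ∈ Ioo a b, Tendsto (fun n => f n t) atTop (𝓝 (g t)))
    (hg : HasDerivAt g g' x) : g' ≤ M := by
  have key : ∀ t ∈ Ioo x b, g t - g x ≤ M * (t - x) := by
    intro t ht
    have ht' : t ∈ Ioo a b := ⟨hx.1.trans ht.1, ht.2⟩
    refine le_of_tendsto ((hlim t ht').sub (hlim x hx)) ?_
    filter_upwards [hM] with n hn
    refine Convex.image_sub_le_mul_sub_of_deriv_le (convex_Ioo a b)
      (fun u hu => (hf n u hu).continuousAt.continuousWithinAt)
      (fun u hu => ?_) (fun u hu => ?_) x hx t ht' ht.1.le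
    · rw [interior_Ioo] at hu
      exact (hf n u hu).differentiableAt.differentiableWithinAt
    · rw [interior_Ioo] at hu
      rw [(hf n u hu).deriv]
      exact hn u hu
  have hslope : Tendsto (slope g x) (𝓝[>] x) (𝓝 g') :=
    (hasDerivAt_iff_tendsto_slope.1 hg).mono_left
      (nhdsWithin_mono x fun t ht => (ne_of_gt ht : t ≠ x))
  refine le_of_tendsto hslope ?_
  filter_upwards [Ioo_mem_nhdsGT hx.2] with t ht
  rw [slope_def_field, div_le_iff₀ (sub_pos.2 ht.1)]
  exact key t ht

/-- An eventual lower bound for the derivatives of a pointwise convergent sequence of functions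
on an interval bounds the derivative of the limit. -/
lemma le_hasDerivAt_of_tendsto {f : ℕ → ℝ → ℝ} {f' : ℕ → ℝ → ℝ} {g : ℝ → ℝ} {g' a b x M : ℝ}
    (hx : x ∈ Ioo a b) (hf : ∀ n, ∀ t ∈ Ioo a b, HasDerivAt (f n) (f' n t) t)
    (hM : ∀ᶠ n in atTop, ∀ t ∈ Ioo a b, M ≤ f' n t)
    (hlim : ∀ t ∈ Ioo a b, Tendsto (fun n => f n t) atTop (𝓝 (g t)))
    (hg : HasDerivAt g g' x) : M ≤ g' := by
  have := hasDerivAt_le_of_tendsto (M := -M) hx (fun n t ht => (hf n t ht).neg)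
    (hM.mono fun n hn t ht => neg_le_neg (hn t ht)) (fun t ht => (hlim t ht).neg) hg.neg
  linarith

/-- The logarithm of the modulus of `Complex.GammaSeq (x + i y) n`. -/
noncomputable def logNormGammaSeq (y : ℝ) (n : ℕ) (x : ℝ) : ℝ :=
  x * Real.log n + Real.log n.factorial -
    ∑ j ∈ Finset.range (n + 1), Real.log ((x + j) ^ 2 + y ^ 2) / 2

lemma log_norm_GammaSeq {x : ℝ} (y : ℝ) (hx : 0 < x) {n : ℕ} (hn : 0 < n) :
    Real.log ‖Complex.GammaSeq (x + y * Complex.I) n‖ = logNormGammaSeq y n x := by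
  have hnorm (j : ℕ) : ‖(x + y * Complex.I + j : ℂ)‖ = √((x + j) ^ 2 + y ^ 2) := by
    rw [← Complex.norm_add_mul_I]
    push_cast
    ring_nf
  have hpos (j : ℕ) : 0 < (x + j) ^ 2 + y ^ 2 := by positivity
  have hsqrt (j : ℕ) : √((x + j) ^ 2 + y ^ 2) ≠ 0 := (Real.sqrt_pos.2 (hpos j)).ne'
  have hn' : (0 : ℝ) < n := by exact_mod_cast hn
  rw [Complex.GammaSeq, norm_div, norm_mul, norm_prod, Complex.norm_natCast_cpow_of_pos hn,
    Complex.norm_natCast]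
  simp_rw [hnorm]
  rw [Real.log_div (by positivity) (Finset.prod_ne_zero_iff.2 fun j _ => hsqrt j),
    Real.log_mul (by positivity) (by positivity), Real.log_rpow hn',
    Real.log_prod fun j _ => hsqrt j]
  simp_rw [fun j : ℕ => Real.log_sqrt (hpos j).le]
  simp [logNormGammaSeq]

lemma tendsto_logNormGammaSeq {x : ℝ} (y : ℝ) (hx : 0 < x) :
    Tendsto (fun n => logNormGammaSeq y n x) atTop
      (𝓝 (Real.log ‖Complex.Gamma (x + y * Complex.I)‖)) := by
  have h0 : Complex.Gamma (x + y * Complex.I) ≠ 0 :=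
    Complex.Gamma_ne_zero_of_re_pos (by simpa using hx)
  refine ((Complex.GammaSeq_tendsto_Gamma _).norm.log (norm_ne_zero_iff.2 h0)).congr' ?_
  filter_upwards [eventually_gt_atTop 0] with n hn
  exact log_norm_GammaSeq y hx hn

lemma hasDerivAt_logNormGammaSeq {x : ℝ} (y : ℝ) (hx : 0 < x) (n : ℕ) :
    HasDerivAt (logNormGammaSeq y n)
      (Real.log n - ∑ j ∈ Finset.range (n + 1), (x + j) / ((x + j) ^ 2 + y ^ 2)) x := by
  have hterm (j : ℕ) : HasDerivAt (fun t : ℝ => Real.log ((t + j) ^ 2 + y ^ 2) / 2)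
      ((x + j) / ((x + j) ^ 2 + y ^ 2)) x := by
    have hpos : 0 < (x + j) ^ 2 + y ^ 2 := by positivity
    refine HasDerivAt.congr_deriv ((((((hasDerivAt_id' x).add_const (j : ℝ)).fun_pow 2).add_const
      (y ^ 2)).log hpos.ne').div_const 2) ?_
    field_simp
    push_cast
    ring
  have hsum := HasDerivAt.fun_sum (u := Finset.range (n + 1)) fun j _ => hterm j
  have := (((hasDerivAt_id x).mul_const (Real.log n)).add_const (Real.log n.factorial)).sub hsum
  rw [one_mul] at this
  exact this

lemma hasDerivAt_log_norm_Gamma {x : ℝ} (y : ℝ) (hx : 0 < x) :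
    HasDerivAt (fun t : ℝ => Real.log ‖Complex.Gamma (t + y * Complex.I)‖)
      (psi (x + y * Complex.I)).re x := by
  set s : ℂ := x + y * Complex.I with hs
  have hre : 0 < s.re := by simpa [hs] using hx
  have h0 : Complex.Gamma s ≠ 0 := Complex.Gamma_ne_zero_of_re_pos hre
  have hd : HasDerivAt Complex.Gamma (deriv Complex.Gamma s) s := by
    refine (Complex.differentiableAt_Gamma s fun m hm => ?_).hasDerivAt
    have : s.re = -m := by rw [hm]; simp
    have hm0 : (0 : ℝ) ≤ m := m.cast_nonneg
    linarith
  have hline : HasDerivAt (fun t : ℝ => (t : ℂ) + y * Complex.I) 1 x :=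
    (Complex.ofRealCLM.hasDerivAt (x := x)).add_const _
  have hcomp : HasDerivAt (fun t : ℝ => Complex.Gamma (t + y * Complex.I))
      (deriv Complex.Gamma s) x := by
    have := HasDerivAt.comp (𝕜 := ℝ) (𝕜' := ℂ) x hd hline
    rw [mul_one] at this
    exact this
  have hlog := (hcomp.norm_sq.log (by simpa using h0)).div_const 2
  have hfun : (fun t : ℝ => Real.log ‖Complex.Gamma (t + y * Complex.I)‖) =
      fun t : ℝ => Real.log (‖Complex.Gamma (t + y * Complex.I)‖ ^ 2) / 2 := by
    ext t
    rw [Real.log_pow]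
    push_cast
    ring
  rw [hfun]
  refine hlog.congr_deriv ?_
  rw [psi, logDeriv_apply, ← hs, Complex.div_re, Complex.inner, ← Complex.normSq_eq_norm_sq]
  have : Complex.normSq (Complex.Gamma s) ≠ 0 := by simpa using h0
  simp only [Complex.mul_re, Complex.conj_re, Complex.conj_im]
  field_simp
  ring

lemma log_one_add_le_div_sqrt {t : ℝ} (ht : 0 ≤ t) : Real.log (1 + t) ≤ t / √(1 + t) := by
  have hpos : 0 < √(1 + t) := Real.sqrt_pos.2 (by linarith)
  have hsq : √(1 + t) ^ 2 = 1 + t := Real.sq_sqrt (by linarith)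
  have h := Real.self_le_sinh_iff.2 (Real.log_nonneg (Real.one_le_sqrt.2 (by linarith : 1 ≤ 1 + t)))
  rw [Real.sinh_log hpos, Real.log_sqrt (by linarith)] at h
  have h2 : √(1 + t) - (√(1 + t))⁻¹ = t / √(1 + t) := by
    field_simp
    linarith
  linarith

lemma half_log_sub_le {u : ℝ} (y : ℝ) (hu : 0 < u) :
    Real.log ((u + 1) ^ 2 - (u + 1) + y ^ 2 + 1 / 2) / 2 - Real.log (u ^ 2 - u + y ^ 2 + 1 / 2) / 2
      ≤ u / (u ^ 2 + y ^ 2) := by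
  set A := u ^ 2 - u + y ^ 2 + 1 / 2 with hA
  have hApos : 0 < A := by nlinarith [sq_nonneg (u - 1 / 2), sq_nonneg y]
  have hstep : (u + 1) ^ 2 - (u + 1) + y ^ 2 + 1 / 2 = A * (1 + 2 * u / A) := by
    field_simp
    rw [hA]
    ring
  have hsqrt : (u ^ 2 + y ^ 2) / A ≤ √(1 + 2 * u / A) := by
    refine Real.le_sqrt_of_sq_le ?_
    rw [div_pow, div_le_iff₀ (by positivity)]
    have : (1 + 2 * u / A) * A ^ 2 = A ^ 2 + 2 * u * A := by field_simp
    rw [this, hA]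
    nlinarith [sq_nonneg y]
  have hr : 0 < u ^ 2 + y ^ 2 := by positivity
  rw [hstep, Real.log_mul hApos.ne' (by positivity)]
  have h1 := log_one_add_le_div_sqrt (t := 2 * u / A) (by positivity)
  have h2 : 2 * u / A / √(1 + 2 * u / A) ≤ 2 * u / A / ((u ^ 2 + y ^ 2) / A) := by gcongr
  have h3 : 2 * u / A / ((u ^ 2 + y ^ 2) / A) = 2 * (u / (u ^ 2 + y ^ 2)) := by field_simp
  linarith

lemma le_half_log_sub {u y : ℝ} (hu : 0 < u) (h : 0 < u ^ 2 - u + y ^ 2) :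
    u / (u ^ 2 + y ^ 2) ≤
      Real.log ((u + 1) ^ 2 - (u + 1) + y ^ 2) / 2 - Real.log (u ^ 2 - u + y ^ 2) / 2 := by
  set A := u ^ 2 - u + y ^ 2 with hA
  have hstep : (u + 1) ^ 2 - (u + 1) + y ^ 2 = A * (1 + 2 * u / A) := by
    field_simp
    rw [hA]
    ring
  have hr : 0 < u ^ 2 + y ^ 2 := by positivity
  rw [hstep, Real.log_mul h.ne' (by positivity)]
  have h1 := Real.le_log_one_add_of_nonneg (x := 2 * u / A) (by positivity)
  have h2 : 2 * (2 * u / A) / (2 * u / A + 2) = 2 * (u / (u ^ 2 + y ^ 2)) := by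
    have : u ^ 2 + y ^ 2 = A + u := by rw [hA]; ring
    rw [this]
    field_simp
    ring
  linarith

/-- An upper bound for `Re ψ` in the right half-plane. -/
lemma re_psi_le {x y a b C : ℝ} (ha : 0 ≤ a) (hx : x ∈ Ioo a b)
    (hC : ∀ t ∈ Ioo a b, t ^ 2 - t + 1 / 2 ≤ C) :
    (psi (x + y * Complex.I)).re ≤ Real.log (y ^ 2 + C) / 2 := by
  refine hasDerivAt_le_of_tendsto hx
    (fun n t ht => hasDerivAt_logNormGammaSeq y (ha.trans_lt ht.1) n) ?_
    (fun t ht => tendsto_logNormGammaSeq y (ha.trans_lt ht.1))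
    (hasDerivAt_log_norm_Gamma y (ha.trans_lt hx.1))
  filter_upwards [eventually_gt_atTop 0] with n hn t ht
  have ht0 : 0 < t := ha.trans_lt ht.1
  let F : ℕ → ℝ := fun j => Real.log ((t + j) ^ 2 - (t + j) + y ^ 2 + 1 / 2) / 2
  have hsum : F (n + 1) - F 0 ≤
      ∑ j ∈ Finset.range (n + 1), (t + j) / ((t + j) ^ 2 + y ^ 2) := by
    rw [← Finset.sum_range_sub]
    refine Finset.sum_le_sum fun j _ => ?_
    have := half_log_sub_le y (u := t + j) (by positivity)
    simpa only [F, Nat.cast_add, Nat.cast_one, add_assoc] using this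
  have hn' : (0 : ℝ) < n := by exact_mod_cast hn
  have hlast : Real.log n ≤ F (n + 1) := by
    have : Real.log ((n : ℝ) ^ 2) ≤
        Real.log ((t + (n + 1 : ℕ)) ^ 2 - (t + (n + 1 : ℕ)) + y ^ 2 + 1 / 2) := by
      refine Real.log_le_log (by positivity) ?_
      push_cast
      nlinarith [sq_nonneg y]
    rw [Real.log_pow] at this
    push_cast at this
    simp only [F]
    push_cast
    linarith
  have hfirst : F 0 ≤ Real.log (y ^ 2 + C) / 2 := by
    have hpos : 0 < t ^ 2 - t + y ^ 2 + 1 / 2 := by nlinarith [sq_nonneg (t - 1 / 2), sq_nonneg y]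
    have := Real.log_le_log hpos (by linarith [hC t ht] : _ ≤ y ^ 2 + C)
    simp only [F, Nat.cast_zero, add_zero]
    linarith
  linarith

/-- A lower bound for `Re ψ` in the right half-plane. -/
lemma le_re_psi {x y a b C : ℝ} (ha : 0 ≤ a) (hx : x ∈ Ioo a b) (hCpos : 0 < y ^ 2 + C)
    (hC : ∀ t ∈ Ioo a b, C ≤ t ^ 2 - t) :
    Real.log (y ^ 2 + C) / 2 ≤ (psi (x + y * Complex.I)).re := by
  have hb : 0 < b := ha.trans_lt (hx.1.trans hx.2)
  refine le_of_forall_pos_sub_le fun ε hε => ?_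
  refine le_hasDerivAt_of_tendsto hx
    (fun n t ht => hasDerivAt_logNormGammaSeq y (ha.trans_lt ht.1) n) ?_
    (fun t ht => tendsto_logNormGammaSeq y (ha.trans_lt ht.1))
    (hasDerivAt_log_norm_Gamma y (ha.trans_lt hx.1))
  have hlim : Tendsto (fun n : ℕ => Real.log ((1 + (b + 1 + |y|) / n) ^ 2) / 2) atTop (𝓝 0) := by
    have h1 : Tendsto (fun n : ℕ => (1 + (b + 1 + |y|) / n) ^ 2) atTop (𝓝 ((1 + 0) ^ 2)) :=
      ((tendsto_const_div_atTop_nhds_zero_nat _).const_add 1).pow 2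
    simpa using (h1.log (by norm_num)).div_const 2
  filter_upwards [eventually_gt_atTop 0, hlim.eventually_le_const hε] with n hn hnε t ht
  have ht0 : 0 < t := ha.trans_lt ht.1
  have hpos (j : ℕ) : 0 < (t + j) ^ 2 - (t + j) + y ^ 2 := by
    have h1 := hC t ht
    have h2 : (j : ℝ) ≤ j ^ 2 := by exact_mod_cast Nat.le_self_pow two_ne_zero j
    have h3 : 0 ≤ t * j := by positivity
    nlinarith
  let F : ℕ → ℝ := fun j => Real.log ((t + j) ^ 2 - (t + j) + y ^ 2) / 2
  have hsum : ∑ j ∈ Finset.range (n + 1), (t + j) / ((t + j) ^ 2 + y ^ 2) ≤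
      F (n + 1) - F 0 := by
    rw [← Finset.sum_range_sub]
    refine Finset.sum_le_sum fun j _ => ?_
    have := le_half_log_sub (u := t + j) (y := y) (by positivity) (hpos j)
    simpa only [F, Nat.cast_add, Nat.cast_one, add_assoc] using this
  have hn' : (0 : ℝ) < n := by exact_mod_cast hn
  have hlast : F (n + 1) ≤ Real.log n + ε := by
    have : Real.log ((t + (n + 1 : ℕ)) ^ 2 - (t + (n + 1 : ℕ)) + y ^ 2) ≤
        Real.log ((n : ℝ) ^ 2 * (1 + (b + 1 + |y|) / n) ^ 2) := by
      refine Real.log_le_log (hpos _) ?_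
      have h1 : (n : ℝ) ^ 2 * (1 + (b + 1 + |y|) / n) ^ 2 = (n + b + 1 + |y|) ^ 2 := by
        field_simp
        ring
      have h2 : (t + (n + 1 : ℕ)) ^ 2 ≤ (n + b + 1) ^ 2 := by
        refine pow_le_pow_left₀ (by positivity) ?_ 2
        push_cast
        linarith [ht.2]
      have h3 : 0 ≤ (n + b + 1) * |y| := by positivity
      rw [h1]
      push_cast at h2 ⊢
      nlinarith [sq_abs y]
    rw [Real.log_mul (by positivity) (by positivity), Real.log_pow] at this
    push_cast at this
    simp only [F]
    push_cast
    linarith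
  have hfirst : Real.log (y ^ 2 + C) / 2 ≤ F 0 := by
    have := Real.log_le_log hCpos (by linarith [hC t ht] : y ^ 2 + C ≤ t ^ 2 - t + y ^ 2)
    simp only [F, Nat.cast_zero, add_zero]
    linarith
  linarith

lemma log_add_sub_kappa_mul_log_le {k : ℕ} (hk1 : 1 ≤ k) (hk4 : k ≤ 4) :
    Real.log ((k : ℝ) ^ 2 / 4 + 0.6) - kappa * Real.log ((k : ℝ) ^ 2 / 4 - 0.16) ≤
      4 * (if k = 1 then 0.3918 else if k = 2 then 0.3915 else if k = 3 then 0.4062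
        else (0.4266 : ℝ)) := by
  have hκ0 : 0 < kappa := by unfold kappa; positivity
  have hκ1 : kappa ≤ 0.448 := by
    have h5 : (2.235 : ℝ) ≤ √5 := Real.le_sqrt_of_sq_le (by norm_num)
    rw [kappa, div_le_iff₀ (by positivity)]
    linarith
  have hlog2 := Real.log_two_lt_d9
  have hlog4 : Real.log 4 = 2 * Real.log 2 := by
    rw [show (4 : ℝ) = 2 ^ 2 by norm_num, Real.log_pow]
    norm_num
  interval_cases k
  · have ha : Real.log 0.85 ≤ 0 := Real.log_nonpos (by norm_num) (by norm_num)
    have hb : -(4 * Real.log 2) ≤ Real.log 0.09 := by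
      have := Real.log_le_log (by norm_num) (by norm_num : ((2 : ℝ) ^ 4)⁻¹ ≤ 0.09)
      rw [Real.log_inv, Real.log_pow] at this
      exact_mod_cast this
    norm_num at ha hb ⊢
    nlinarith
  · have ha := Real.log_le_sub_one_of_pos (by norm_num : (0 : ℝ) < 1.6)
    have hb := Real.one_sub_inv_le_log_of_pos (by norm_num : (0 : ℝ) < 0.84)
    norm_num at ha hb ⊢
    nlinarith
  · have ha := Real.log_le_log (by norm_num) (by norm_num : (2.85 : ℝ) ≤ 4)
    have hb := mul_nonneg hκ0.le (Real.log_nonneg (by norm_num : (1 : ℝ) ≤ 2.09))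
    norm_num at ha hb ⊢
    linarith
  · have ha := Real.log_le_sub_one_of_pos (by norm_num : (0 : ℝ) < 1.15)
    have ha' : Real.log 4.6 = Real.log 4 + Real.log 1.15 := by
      rw [← Real.log_mul (by norm_num) (by norm_num)]
      norm_num
    have hb := mul_nonneg hκ0.le (Real.log_nonneg (by norm_num : (1 : ℝ) ≤ 3.84))
    norm_num at ha ha' hb ⊢
    linarith

/-- For `1 < σ ≤ 1.15`, `c ∈ {0,1}`, `k ∈ {1,2,3,4}`, `γ0 > 1`:
`(1/2) Re( ψ((σ+ikγ0+c)/2) - κ ψ((σ1+ikγ0+c)/2) ) ≤ ((1-κ)/2) log γ0 + D(k)`, with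
`D(1) = 0.3918`, `D(2) = 0.3915`, `D(3) = 0.4062`, `D(4) = 0.4266`. -/
theorem gamma_term_large_t (σ c γ0 : ℝ) (hσ : 1 < σ) (hσ' : σ ≤ 1.15)
    (hc : c = 0 ∨ c = 1) (k : ℕ) (hk1 : 1 ≤ k) (hk4 : k ≤ 4) (hγ0 : 1 < γ0) :
    (1 / 2) * (psi (((σ : ℂ) + ((k : ℝ) * γ0 : ℝ) * Complex.I + (c : ℂ)) / 2)
        - (kappa : ℂ) *
          psi (((sigma1 σ : ℂ) + ((k : ℝ) * γ0 : ℝ) * Complex.I + (c : ℂ)) / 2)).re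
      ≤ (1 - kappa) / 2 * Real.log γ0 + (if k = 1 then 0.3918 else if k = 2 then 0.3915 else if k = 3 then 0.4062 else (0.4266 : ℝ)) := by
  have hc0 : 0 ≤ c := by rcases hc with rfl | rfl <;> norm_num
  have hc1 : c ≤ 1 := by rcases hc with rfl | rfl <;> norm_num
  have hκ0 : 0 < kappa := by unfold kappa; positivity
  have hk : (1 : ℝ) ≤ k := by exact_mod_cast hk1
  have hγ : 0 < γ0 := by linarith
  have hσ1 : 1.6 < sigma1 σ := by
    have : 2.2 < √(1 + 4 * σ ^ 2) := Real.lt_sqrt_of_sq_lt (by nlinarith)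
    rw [sigma1]
    linarith
  have hsplit (r : ℝ) : ((r : ℂ) + ((k : ℝ) * γ0 : ℝ) * Complex.I + (c : ℂ)) / 2 =
      ((r + c) / 2 : ℝ) + ((k : ℝ) * γ0 / 2 : ℝ) * Complex.I := by
    push_cast
    ring
  rw [hsplit, hsplit, Complex.sub_re, Complex.re_ofReal_mul]
  set y : ℝ := k * γ0 / 2 with hy
  have hγsq : 1 ≤ γ0 ^ 2 := one_le_pow₀ hγ0.le
  have hy2 : y ^ 2 = (k : ℝ) ^ 2 / 4 * γ0 ^ 2 := by rw [hy]; ring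
  have hk2 : 1 / 4 ≤ (k : ℝ) ^ 2 / 4 := by nlinarith
  have hupper := re_psi_le (x := (σ + c) / 2) (y := y) (a := 0) (b := 1.08) (C := 0.6) le_rfl
    ⟨by linarith, by linarith⟩ fun t ht => by nlinarith [ht.1, ht.2]
  have hlower := le_re_psi (x := (sigma1 σ + c) / 2) (y := y) (a := 0.8)
    (b := (sigma1 σ + c) / 2 + 1) (C := -0.16) (by norm_num) ⟨by linarith, by linarith⟩
    (by rw [hy2]; nlinarith) fun t ht => by nlinarith [ht.1]
  have hlogγ : Real.log (γ0 ^ 2) = 2 * Real.log γ0 := by simp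
  have hlogupper : Real.log (y ^ 2 + 0.6) ≤
      Real.log ((k : ℝ) ^ 2 / 4 + 0.6) + 2 * Real.log γ0 := by
    rw [← hlogγ, ← Real.log_mul (by positivity) (by positivity)]
    exact Real.log_le_log (by positivity) (by rw [hy2]; nlinarith)
  have hloglower : Real.log ((k : ℝ) ^ 2 / 4 - 0.16) + 2 * Real.log γ0 ≤
      Real.log (y ^ 2 + -0.16) := by
    have hpos : 0 < (k : ℝ) ^ 2 / 4 - 0.16 := by linarith
    rw [← hlogγ, ← Real.log_mul hpos.ne' (by positivity)]
    exact Real.log_le_log (by positivity) (by rw [hy2]; nlinarith)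
  have hκlower := mul_le_mul_of_nonneg_left
    (by linarith : Real.log ((k : ℝ) ^ 2 / 4 - 0.16) / 2 + Real.log γ0 ≤
      (psi (((sigma1 σ + c) / 2 : ℝ) + (y : ℝ) * Complex.I)).re) hκ0.le
  have hconst := log_add_sub_kappa_mul_log_le hk1 hk4
  linarith

end ZFR
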